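/- Let m, n be positive integers and let F be a binary image contained in {1,…,m} × {1,…,n} with row sums r_1,…,r_m and column sums c_1,…,c_n. Define b_i = #{j ∈ {1,…,n} : c_j ≥ i} and d_i = b_i − r_i for i = 1,…,m, set d_0 = d_{m+1} = 0, and let L_h be the length of the horizontal boundary of F. Suppose k is an integer with 1 ≤ k ≤ m such that d_k < 0 and d_{k+1} ≥ 0, and set σ = Σ_{i=1}^{k} d_i. Then for all integers t, s ≥ 0, every set {i_1 < i_2 < ⋯ < i_{2t+1}} ⊆ {0, 1, …, k−1, k, m+1}, and every set {ĩ_1 < ĩ_2 < ⋯ < ĩ_{2s+1}} ⊆ {0, k+1, k+2, …, m, m+1}, one has L_h ≥ 2·r_1 + (d_{i_1} − d_{i_2} + d_{i_3} − ⋯ − d_{i_{2t}} + 2·d_{i_{2t+1}}) + (d_{ĩ_1} − d_{ĩ_2} + d_{ĩ_3} − ⋯ − d_{ĩ_{2s}} + 2·d_{ĩ_{2s+1}}) − σ. -/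

import Mathlib

/-- The row sum `r i` of a binary image `F`: the number of points of `F` in row `i`. -/
def rowSum (F : Finset (ℤ × ℤ)) (i : ℤ) : ℕ := (F.filter fun p => p.1 = i).card

/-- The column sum `c j` of a binary image `F`: the number of points of `F` in column `j`. -/
def colSum (F : Finset (ℤ × ℤ)) (j : ℤ) : ℕ := (F.filter fun p => p.2 = j).card

/-- The length of the horizontal boundary of `F`: the number of pairs
`((i,j),(i',j'))` with `j = j'`, `|i - i'| = 1`, `(i,j) ∈ F` and `(i',j') ∉ F`. -/
noncomputable def horizBoundaryLen (F : Finset (ℤ × ℤ)) : ℕ :=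
  Set.ncard {q : (ℤ × ℤ) × (ℤ × ℤ) |
    q.1.2 = q.2.2 ∧ |q.1.1 - q.2.1| = 1 ∧ q.1 ∈ F ∧ q.2 ∉ F}

theorem alt_le (f : ℕ → ℤ) (v : ℕ → ℕ) (a : ℕ) : ∀ (t b : ℕ),
    (∀ i j, i < j → j < 2 * t → v i < v j) → (∀ i, i < 2 * t → a ≤ v i ∧ v i ≤ b) →
    ∑ u ∈ Finset.range t, (f (v (2 * u)) - f (v (2 * u + 1)))
      ≤ ∑ i ∈ Finset.Ico a b, max 0 (f i - f (i + 1)) := by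
  intro t
  induction t with
  | zero =>
    intro b _ _
    simp only [Finset.range_zero, Finset.sum_empty]
    exact Finset.sum_nonneg (fun i _ => le_max_left _ _)
  | succ t ih =>
    intro b hm hr
    rw [Finset.sum_range_succ]
    have h1 := ih (v (2 * t)) (fun i j hij hj => hm i j hij (by omega))
      (fun i hi => ⟨(hr i (by omega)).1, (hm i (2 * t) hi (by omega)).le⟩)
    have ha := hr (2 * t) (by omega)
    have hb := hr (2 * t + 1) (by omega)
    have hab := hm (2 * t) (2 * t + 1) (by omega) (by omega)
    have h2 : f (v (2 * t)) - f (v (2 * t + 1)) ≤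
        ∑ i ∈ Finset.Ico (v (2 * t)) (v (2 * t + 1)), max 0 (f i - f (i + 1)) := by
      have : ∑ i ∈ Finset.Ico (v (2 * t)) (v (2 * t + 1)), (f (i + 1) - f i)
          = f (v (2 * t + 1)) - f (v (2 * t)) := Finset.sum_Ico_sub f hab.le
      have h3 : ∑ i ∈ Finset.Ico (v (2 * t)) (v (2 * t + 1)), (f i - f (i + 1)) ≤
        ∑ i ∈ Finset.Ico (v (2 * t)) (v (2 * t + 1)), max 0 (f i - f (i + 1)) :=
        Finset.sum_le_sum (fun i _ => le_max_right _ _)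
      have h4 : ∑ i ∈ Finset.Ico (v (2 * t)) (v (2 * t + 1)), (f i - f (i + 1)) =
        - ∑ i ∈ Finset.Ico (v (2 * t)) (v (2 * t + 1)), (f (i + 1) - f i) := by
        rw [← Finset.sum_neg_distrib]
        exact Finset.sum_congr rfl (fun i _ => by ring)
      linarith
    have h5 := Finset.sum_Ico_consecutive (fun i => max 0 (f i - f (i + 1))) ha.1 hab.le
    have h6 := Finset.sum_Ico_consecutive (fun i => max 0 (f i - f (i + 1)))
      (ha.1.trans hab.le) hb.2
    have h7 : 0 ≤ ∑ i ∈ Finset.Ico (v (2 * t + 1)) b, max 0 (f i - f (i + 1)) :=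
      Finset.sum_nonneg (fun i _ => le_max_left _ _)
    linarith

/-- total rise of `x` on `[a,b]` -/
def rise (x : ℕ → ℤ) (a b : ℕ) : ℤ := ∑ i ∈ Finset.Ico a b, max 0 (x (i + 1) - x i)

/-- total descent of `x` on `[a,b]` -/
def desc (x : ℕ → ℤ) (a b : ℕ) : ℤ := ∑ i ∈ Finset.Ico a b, max 0 (x i - x (i + 1))

theorem rise_nonneg (x : ℕ → ℤ) (a b : ℕ) : 0 ≤ rise x a b :=
  Finset.sum_nonneg (fun _ _ => le_max_left _ _)

theorem rise_add (x : ℕ → ℤ) {a b c : ℕ} (h : a ≤ b) (h' : b ≤ c) :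
    rise x a b + rise x b c = rise x a c :=
  Finset.sum_Ico_consecutive _ h h'

theorem le_rise (x : ℕ → ℤ) {a b : ℕ} (h : a ≤ b) : x b - x a ≤ rise x a b := by
  rw [← Finset.sum_Ico_sub x h]
  exact Finset.sum_le_sum (fun i _ => le_max_right _ _)

theorem rise_le_zeros (x : ℕ → ℤ) (hx : ∀ i, x i = 0 ∨ x i = 1) (a b : ℕ) :
    rise x a b ≤ ∑ i ∈ Finset.Ico a b, (1 - x i) := by
  refine Finset.sum_le_sum (fun i _ => ?_)
  rcases hx i with h | h <;> rcases hx (i + 1) with h' | h' <;> simp [h, h']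

structure Col (m c : ℕ) (x e : ℕ → ℤ) : Prop where
  hx : ∀ i, x i = 0 ∨ x i = 1
  hxm : ∀ i, m < i → x i = 0
  hc : (c : ℤ) = ∑ i ∈ Finset.Ico 1 (m + 1), x i
  he : ∀ i, 1 ≤ i → e i = (if i ≤ c then 1 else 0) - x i
  he0 : e 0 = 0

namespace Col
variable {m c : ℕ} {x e : ℕ → ℤ}

theorem x0 (h : Col m c x e) (i : ℕ) : 0 ≤ x i := by rcases h.hx i with h | h <;> simp [h]
theorem x1 (h : Col m c x e) (i : ℕ) : x i ≤ 1 := by rcases h.hx i with h | h <;> simp [h]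

theorem cm (h : Col m c x e) : c ≤ m := by
  have := Finset.sum_le_sum (s := Finset.Ico 1 (m + 1)) (fun i _ => h.x1 i)
  rw [← h.hc] at this
  simp at this
  exact_mod_cast this

theorem F2 (h : Col m c x e) {p : ℕ} (hp : 1 ≤ p) (hpc : p ≤ c) (hxp : x p = 0) :
    1 ≤ rise x p (m + 1) := by
  by_contra hcon
  have hcm := h.cm
  have hz : ∀ i ∈ Finset.Ico p (m + 1), x i = 0 := by
    intro i hi
    rw [Finset.mem_Ico] at hi
    have h1 := le_rise x hi.1
    have h2 := rise_add x hi.1 hi.2.le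
    have h3 := rise_nonneg x i (m + 1)
    have := h.x0 i
    linarith
  have hs := Finset.sum_Ico_consecutive x hp (by omega : p ≤ m + 1)
  rw [← h.hc, Finset.sum_eq_zero hz] at hs
  have := Finset.sum_le_sum (s := Finset.Ico 1 p) (fun i _ => h.x1 i)
  simp at this
  push_cast [hp] at this
  omega

theorem F3 (h : Col m c x e) (hc1 : 1 ≤ c) :
    1 - max 0 (x c - x (c + 1)) ≤ rise x 1 (m + 1) := by
  have hcm := h.cm
  by_contra hcon
  have hU := rise_nonneg x 1 (m + 1)
  have hanti : ∀ i j, 1 ≤ i → i ≤ j → j ≤ m + 1 → x j ≤ x i := by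
    intro i j hi hij hj
    have h1 := le_rise x hij
    have h2 := rise_add x hi (hij.trans hj)
    have h3 := rise_add x hij hj
    have h4 := rise_nonneg x 1 i
    have h5 := rise_nonneg x j (m + 1)
    have h6 : 0 ≤ max 0 (x c - x (c + 1)) := le_max_left _ _
    linarith
  rcases h.hx c with h0 | h0
  · have := h.F2 hc1 le_rfl h0
    have h2 := rise_add x hc1 (by omega : c ≤ m + 1)
    have h4 := rise_nonneg x 1 c
    have h6 : 0 ≤ max 0 (x c - x (c + 1)) := le_max_left _ _
    linarith
  · rcases h.hx (c + 1) with h1 | h1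
    · rw [h0, h1] at hcon
      simp at hcon
      omega
    · have hlt : c + 1 ≤ m := by
        by_contra hh
        have := h.hxm (c + 1) (by omega)
        omega
      have hs := Finset.sum_Ico_consecutive x (by omega : 1 ≤ c + 2) (by omega : c + 2 ≤ m + 1)
      rw [← h.hc] at hs
      have h7 : ∑ i ∈ Finset.Ico 1 (c + 2), (1 : ℤ) ≤ ∑ i ∈ Finset.Ico 1 (c + 2), x i := by
        refine Finset.sum_le_sum (fun i hi => ?_)
        rw [Finset.mem_Ico] at hi
        have := hanti i (c + 1) hi.1 (by omega) (by omega)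
        omega
      have h8 : 0 ≤ ∑ i ∈ Finset.Ico (c + 2) (m + 1), x i :=
        Finset.sum_nonneg (fun i _ => h.x0 i)
      simp at h7
      omega

theorem desc_eq (h : Col m c x e) {a p : ℕ} (ha : 1 ≤ a) :
    desc e a p = rise x a p + (if a ≤ c ∧ c < p then 1 - max 0 (x c - x (c + 1)) else 0) := by
  have h1 : ∀ i ∈ Finset.Ico a p, max 0 (e i - e (i + 1)) =
      max 0 (x (i + 1) - x i) + (if c = i then 1 - max 0 (x c - x (c + 1)) else 0) := by
    intro i hi
    rw [Finset.mem_Ico] at hi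
    rw [h.he i (by omega), h.he (i + 1) (by omega)]
    by_cases hci : c = i
    · subst hci
      rcases h.hx c with h1 | h1 <;> rcases h.hx (c + 1) with h2 | h2 <;> simp [h1, h2]
    · by_cases hlt : i ≤ c
      · have : i + 1 ≤ c := by omega
        simp [hci, hlt, this]
      · have : ¬ i + 1 ≤ c := by omega
        simp only [hci, hlt, this, if_false]
        congr 1
        ring_nf
  unfold desc rise
  rw [Finset.sum_congr rfl h1, Finset.sum_add_distrib, Finset.sum_ite_eq]
  simp only [Finset.mem_Ico]

theorem cross_le (h : Col m c x e) {a p : ℕ} (ha : 1 ≤ a) :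
    (if a ≤ c ∧ c < p then 1 - max 0 (x c - x (c + 1)) else 0) ≤ min 1 (rise x 1 (m + 1)) := by
  have hU := rise_nonneg x 1 (m + 1)
  have hm : 0 ≤ max 0 (x c - x (c + 1)) := le_max_left _ _
  refine le_min ?_ ?_
  · split_ifs <;> linarith
  · split_ifs with hh
    · exact h.F3 (by omega)
    · exact hU

theorem e_nonpos (h : Col m c x e) {q : ℕ} (hq : c < q) : e q ≤ 0 := by
  rw [h.he q (by omega), if_neg (by omega)]
  have := h.x0 q
  linarith

theorem rise_mono (_h : Col m c x e) {a q : ℕ} (ha : 1 ≤ a) (haq : a ≤ q) (hq : q ≤ m + 1) :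
    rise x a q ≤ rise x a (m + 1) ∧ rise x a (m + 1) ≤ rise x 1 (m + 1) := by
  have h1 := rise_add x haq hq
  have h2 := rise_add x ha (haq.trans hq)
  have h3 := rise_nonneg x q (m + 1)
  have h4 := rise_nonneg x 1 a
  constructor <;> linarith

theorem F4c (h : Col m c x e) {a q : ℕ} (ha : 1 ≤ a) (haq : a ≤ q) (hq : q ≤ m + 1) :
    desc e a q ≤ 2 * rise x 1 (m + 1) := by
  rw [h.desc_eq ha]
  have := le_min_iff.1 (h.cross_le (p := q) ha)
  have := h.rise_mono ha haq hq
  linarith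

theorem F4 (h : Col m c x e) {a q : ℕ} (ha : 1 ≤ a) (haq : a ≤ q) (hq : q ≤ m + 1) :
    desc e a q + 2 * e q ≤ 2 * rise x 1 (m + 1) ∧
    desc e a q + 2 * e q ≤ 2 * rise x a (m + 1) + 1 := by
  have hm := h.rise_mono ha haq hq
  have hc := le_min_iff.1 (h.cross_le (p := q) ha)
  have h0 := rise_nonneg x a (m + 1)
  have h00 := rise_nonneg x a q
  by_cases hq0 : e q ≤ 0
  · rw [h.desc_eq ha]
    constructor <;> linarith
  · have hqc : q ≤ c := by
      by_contra hh
      exact hq0 (h.e_nonpos (by omega))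
    have heq := h.he q (by omega)
    rw [if_pos hqc] at heq
    have hxq : x q = 0 := by
      rcases h.hx q with h | h
      · exact h
      · omega
    have := h.F2 (ha.trans haq) hqc hxq
    have h2 := rise_add x haq hq
    rw [h.desc_eq ha, if_neg (by omega), heq, hxq]
    constructor <;> linarith

theorem desc_zero (h : Col m c x e) (p : ℕ) (hp : 1 ≤ p) : desc e 0 p = desc e 1 p := by
  unfold desc
  rw [Finset.sum_eq_sum_Ico_succ_bot (by omega), h.he0]
  have : 0 ≤ e 1 := by
    rw [h.he 1 le_rfl]
    split_ifs with hh
    · have := h.x1 1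
      linarith
    · have h0 : c = 0 := by omega
      by_cases hm : 1 ≤ m
      · have := Finset.single_le_sum (f := x) (s := Finset.Ico 1 (m + 1)) (fun i _ => h.x0 i)
          (Finset.mem_Ico.2 ⟨le_rfl, by omega⟩)
        rw [← h.hc, h0] at this
        simpa using this
      · rw [h.hxm 1 (by omega)]
        simp
  rw [max_eq_left (by linarith)]
  simp

theorem main (h : Col m c x e) {k q : ℕ} (hk : 1 ≤ k) (hkm : k ≤ m) (hkq : k + 1 ≤ q)
    (hq : q ≤ m + 1) (A : ℤ) (hA : A = desc e 0 k ∨ ∃ p, p < k ∧ A = desc e 0 p + 2 * e p) :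
    2 * x 1 + A + (desc e (k + 1) q + 2 * e q) - ∑ i ∈ Finset.Ico 1 (k + 1), e i
      ≤ 2 * (x 1 + rise x 1 (m + 1)) := by
  have hU := rise_nonneg x 1 (m + 1)
  have hes : ∑ i ∈ Finset.Ico 1 (k + 1), e i =
      ∑ i ∈ Finset.Ico 1 (k + 1), ((if i ≤ c then 1 else 0) - x i) :=
    Finset.sum_congr rfl (fun i hi => h.he i (Finset.mem_Ico.1 hi).1)
  by_cases hck : c ≤ k
  · -- first case
    have hB : desc e (k + 1) q + 2 * e q ≤ ∑ i ∈ Finset.Ico 1 (k + 1), e i := by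
      have h1 := h.e_nonpos (q := q) (by omega)
      rw [h.desc_eq (by omega), if_neg (by omega), hes, Finset.sum_sub_distrib]
      have h2 := (h.rise_mono (by omega) hkq hq).1
      have h3 : rise x (k + 1) (m + 1) ≤ ∑ i ∈ Finset.Ico (k + 1) (m + 1), x i := by
        have h4 : rise x (k + 1) (m + 1) ≤ ∑ i ∈ Finset.Ico (k + 1) (m + 1), x (i + 1) := by
          refine Finset.sum_le_sum (fun i _ => ?_)
          have := h.x0 i
          have := h.x0 (i + 1)
          exact max_le (by linarith) (by linarith)
        have h5 := Finset.sum_Ico_sub x (by omega : k + 1 ≤ m + 1)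
        rw [Finset.sum_sub_distrib, h.hxm (m + 1) (by omega)] at h5
        have := h.x0 (k + 1)
        linarith
      have h6 := Finset.sum_Ico_consecutive x (by omega : 1 ≤ k + 1) (by omega : k + 1 ≤ m + 1)
      rw [← h.hc] at h6
      have h7 : ∑ i ∈ Finset.Ico 1 (k + 1), (if i ≤ c then (1 : ℤ) else 0) = c := by
        rw [← Finset.sum_filter]
        have : (Finset.Ico 1 (k + 1)).filter (fun i => i ≤ c) = Finset.Ico 1 (c + 1) := by
          ext i
          simp only [Finset.mem_filter, Finset.mem_Ico]
          omega
        rw [this]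
        simp
      linarith
    have hA2 : A ≤ 2 * rise x 1 (m + 1) := by
      rcases hA with rfl | ⟨p, hp, rfl⟩
      · rw [h.desc_zero k hk]
        exact h.F4c le_rfl hk (by omega)
      · by_cases hp0 : p = 0
        · subst hp0
          simp [desc, h.he0, hU]
        · rw [h.desc_zero p (by omega)]
          exact (h.F4 le_rfl (by omega) (by omega)).1
    linarith
  · have hes' : ∑ i ∈ Finset.Ico 1 (k + 1), e i = ∑ i ∈ Finset.Ico 1 (k + 1), (1 - x i) := by
      rw [hes]
      refine Finset.sum_congr rfl (fun i hi => ?_)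
      rw [Finset.mem_Ico] at hi
      rw [if_pos (by omega)]
    rw [hes']
    have hB := h.F4 (by omega) hkq hq
    have hz : ∀ a b, 0 ≤ ∑ i ∈ Finset.Ico a b, (1 - x i) := fun a b =>
      Finset.sum_nonneg (fun i _ => by have := h.x1 i; linarith)
    have hsp : ∀ a b, 1 ≤ a → a ≤ b → b ≤ k + 1 → ∑ i ∈ Finset.Ico a b, (1 - x i) +
        ∑ i ∈ Finset.Ico b (k + 1), (1 - x i) = ∑ i ∈ Finset.Ico a (k + 1), (1 - x i) :=
      fun a b _ h1 h2 => Finset.sum_Ico_consecutive _ h1 h2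
    rcases hA with rfl | ⟨p, hp, rfl⟩
    · rw [h.desc_zero k hk, h.desc_eq le_rfl, if_neg (by omega)]
      have h1 := rise_le_zeros x h.hx 1 k
      have h2 := hsp 1 k le_rfl hk (by omega)
      have h3 := hz k (k + 1)
      linarith
    · by_cases hp0 : p = 0
      · subst hp0
        have := hz 1 (k + 1)
        simp only [desc, h.he0, Finset.Ico_self, Finset.sum_empty] at hB ⊢
        linarith
      · rw [h.desc_zero p (by omega), h.desc_eq le_rfl, if_neg (by omega), h.he p (by omega),
          if_pos (by omega)]
        have h1 := rise_le_zeros x h.hx 1 p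
        have h2 := hsp 1 p le_rfl (by omega) (by omega)
        rcases h.hx p with hxp | hxp
        · have h3 := Finset.sum_eq_sum_Ico_succ_bot (by omega : p < k + 1) (fun i => 1 - x i)
          have h4 := hsp (p + 1) k (by omega) (by omega) (by omega)
          have h5 := hz (p + 1) k
          have h6 : ∑ i ∈ Finset.Ico k (k + 1), (1 - x i) = 1 - x k := by simp
          rcases h.hx k with hxk | hxk
          · linarith
          · have h7 := le_rise x hp.le
            have h8 := rise_add x (by omega : 1 ≤ p) hp.le
            have h9 := rise_add x hk (by omega : k ≤ k + 1)
            have h10 := rise_add x (by omega : 1 ≤ k + 1) (by omega : k + 1 ≤ m + 1)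
            have h11 := rise_nonneg x 1 p
            have h12 := rise_nonneg x k (k + 1)
            linarith
        · have h3 := hz p (k + 1)
          linarith

end Col

/-- indicator of column `j` -/
def colX (F : Finset (ℤ × ℤ)) (j : ℤ) (i : ℕ) : ℤ := if ((i : ℤ), j) ∈ F then 1 else 0

/-- per-column contribution to `d` -/
def colE (F : Finset (ℤ × ℤ)) (j : ℤ) (i : ℕ) : ℤ :=
  if i = 0 then 0 else (if i ≤ colSum F j then 1 else 0) - colX F j i

theorem colSum_eq (m n : ℕ) (F : Finset (ℤ × ℤ))
    (hF : ∀ p ∈ F, p.1 ∈ Finset.Icc (1 : ℤ) (m : ℤ) ∧ p.2 ∈ Finset.Icc (1 : ℤ) (n : ℤ)) (j : ℤ) :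
    (colSum F j : ℤ) = ∑ i ∈ Finset.Ico 1 (m + 1), colX F j i := by
  unfold colSum colX
  rw [← Finset.sum_filter, Finset.sum_const, nsmul_eq_mul, mul_one]
  congr 1
  refine Finset.card_nbij' (fun p => p.1.toNat) (fun i => ((i : ℤ), j)) ?_ ?_ ?_ ?_
  · rintro ⟨a, b⟩ hp
    simp only [Finset.coe_filter, Set.mem_setOf_eq] at hp
    obtain ⟨hp, rfl⟩ := hp
    have := hF _ hp
    simp only [Finset.mem_Icc] at this
    have h1 : ((a.toNat : ℕ) : ℤ) = a := Int.toNat_of_nonneg (by omega)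
    simp only [Finset.coe_filter, Set.mem_setOf_eq, Finset.mem_Ico, h1, hp, and_true]
    omega
  · intro i hi
    simp only [Finset.coe_filter, Set.mem_setOf_eq] at hi ⊢
    exact ⟨hi.2, trivial⟩
  · rintro ⟨a, b⟩ hp
    simp only [Finset.coe_filter, Set.mem_setOf_eq] at hp
    obtain ⟨hp, rfl⟩ := hp
    have := hF _ hp
    simp only [Finset.mem_Icc] at this
    have h1 : ((a.toNat : ℕ) : ℤ) = a := Int.toNat_of_nonneg (by omega)
    simp [h1]
  · intro i hi
    simp

theorem rowSum_eq (m n : ℕ) (F : Finset (ℤ × ℤ))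
    (hF : ∀ p ∈ F, p.1 ∈ Finset.Icc (1 : ℤ) (m : ℤ) ∧ p.2 ∈ Finset.Icc (1 : ℤ) (n : ℤ)) (i : ℕ) :
    (rowSum F i : ℤ) = ∑ j ∈ Finset.Icc (1 : ℤ) n, colX F j i := by
  unfold rowSum colX
  rw [← Finset.sum_filter, Finset.sum_const, nsmul_eq_mul, mul_one]
  congr 1
  refine Finset.card_nbij' (fun p => p.2) (fun j => ((i : ℤ), j)) ?_ ?_ ?_ ?_
  · rintro ⟨a, b⟩ hp
    simp only [Finset.coe_filter, Set.mem_setOf_eq] at hp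
    obtain ⟨hp, rfl⟩ := hp
    have := hF _ hp
    simp only [Finset.coe_filter, Set.mem_setOf_eq]
    exact ⟨this.2, hp⟩
  · intro j hj
    simp only [Finset.coe_filter, Set.mem_setOf_eq] at hj ⊢
    exact ⟨hj.2, trivial⟩
  · rintro ⟨a, b⟩ hp
    simp only [Finset.coe_filter, Set.mem_setOf_eq] at hp
    simp [hp.2]
  · intro j hj
    simp

theorem col_of (m n : ℕ) (F : Finset (ℤ × ℤ))
    (hF : ∀ p ∈ F, p.1 ∈ Finset.Icc (1 : ℤ) (m : ℤ) ∧ p.2 ∈ Finset.Icc (1 : ℤ) (n : ℤ)) (j : ℤ) :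
    Col m (colSum F j) (colX F j) (colE F j) where
  hx i := by
    unfold colX
    split_ifs <;> simp
  hxm i hi := by
    unfold colX
    rw [if_neg]
    intro hp
    have := (hF _ hp).1
    simp only [Finset.mem_Icc] at this
    omega
  hc := colSum_eq m n F hF j
  he i hi := by
    unfold colE
    rw [if_neg (by omega)]
  he0 := by simp [colE]

theorem boundary_ge (m n : ℕ) (F : Finset (ℤ × ℤ))
    (hF : ∀ p ∈ F, p.1 ∈ Finset.Icc (1 : ℤ) (m : ℤ) ∧ p.2 ∈ Finset.Icc (1 : ℤ) (n : ℤ)) :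
    ∑ j ∈ Finset.Icc (1 : ℤ) n, 2 * (colX F j 1 + rise (colX F j) 1 (m + 1))
      ≤ (horizBoundaryLen F : ℤ) := by
  classical
  have hX0 : ∀ j, colX F j 0 = 0 := by
    intro j
    unfold colX
    rw [if_neg]
    intro hp
    have := (hF _ hp).1
    simp at this
  have hrow : ∀ j, 2 * (colX F j 1 + rise (colX F j) 1 (m + 1)) =
      rise (colX F j) 0 (m + 1) + desc (colX F j) 0 (m + 1) := by
    intro j
    have h1 : rise (colX F j) 0 (m + 1) = colX F j 1 + rise (colX F j) 1 (m + 1) := by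
      unfold rise
      rw [Finset.sum_eq_sum_Ico_succ_bot (by omega), hX0]
      have := (col_of m n F hF j).x0 1
      simp [this]
    have h2 : rise (colX F j) 0 (m + 1) - desc (colX F j) 0 (m + 1) = 0 := by
      unfold rise desc
      rw [← Finset.sum_sub_distrib]
      have h3 := Finset.sum_Ico_sub (colX F j) (by omega : 0 ≤ m + 1)
      rw [hX0, (col_of m n F hF j).hxm (m + 1) (by omega)] at h3
      rw [show (0 : ℤ) = 0 - 0 by simp, ← h3]
      refine Finset.sum_congr rfl (fun i _ => ?_)
      omega
    linarith
  rw [Finset.sum_congr rfl (fun j _ => hrow j), Finset.sum_add_distrib]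
  set I := Finset.Icc (1 : ℤ) n ×ˢ Finset.Ico 0 (m + 1) with hI
  set U := I.filter (fun p : ℤ × ℕ => ((p.2 : ℤ) + 1, p.1) ∈ F ∧ ((p.2 : ℤ), p.1) ∉ F) with hU
  set D := I.filter (fun p : ℤ × ℕ => ((p.2 : ℤ), p.1) ∈ F ∧ ((p.2 : ℤ) + 1, p.1) ∉ F) with hD
  have hUc : ∑ j ∈ Finset.Icc (1 : ℤ) n, rise (colX F j) 0 (m + 1) = U.card := by
    rw [hU, Finset.card_filter, hI, Finset.sum_product]
    push_cast
    refine Finset.sum_congr rfl (fun j _ => Finset.sum_congr rfl (fun i _ => ?_))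
    unfold colX
    push_cast
    by_cases h1 : ((i : ℤ) + 1, j) ∈ F <;> by_cases h2 : ((i : ℤ), j) ∈ F <;> simp [h1, h2]
  have hDc : ∑ j ∈ Finset.Icc (1 : ℤ) n, desc (colX F j) 0 (m + 1) = D.card := by
    rw [hD, Finset.card_filter, hI, Finset.sum_product]
    push_cast
    refine Finset.sum_congr rfl (fun j _ => Finset.sum_congr rfl (fun i _ => ?_))
    unfold colX
    push_cast
    by_cases h1 : ((i : ℤ) + 1, j) ∈ F <;> by_cases h2 : ((i : ℤ), j) ∈ F <;> simp [h1, h2]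
  rw [hUc, hDc]
  let fU : ℤ × ℕ → (ℤ × ℤ) × (ℤ × ℤ) := fun p => (((p.2 : ℤ) + 1, p.1), ((p.2 : ℤ), p.1))
  let fD : ℤ × ℕ → (ℤ × ℤ) × (ℤ × ℤ) := fun p => (((p.2 : ℤ), p.1), ((p.2 : ℤ) + 1, p.1))
  have iU : Function.Injective fU := by
    rintro ⟨a, b⟩ ⟨a', b'⟩ h
    simp only [fU, Prod.mk.injEq] at h
    ext
    · exact h.1.2
    · simpa using h.2.1
  have iD : Function.Injective fD := by
    rintro ⟨a, b⟩ ⟨a', b'⟩ h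
    simp only [fD, Prod.mk.injEq] at h
    ext
    · exact h.1.2
    · simpa using h.1.1
  have hdisj : Disjoint (U.image fU) (D.image fD) := by
    rw [Finset.disjoint_left]
    intro q hq hq'
    obtain ⟨⟨a, b⟩, -, rfl⟩ := Finset.mem_image.1 hq
    obtain ⟨⟨a', b'⟩, -, h⟩ := Finset.mem_image.1 hq'
    simp only [fU, fD, Prod.mk.injEq] at h
    omega
  have hcard : (U.image fU ∪ D.image fD).card = U.card + D.card := by
    rw [Finset.card_union_of_disjoint hdisj, Finset.card_image_of_injective _ iU,
      Finset.card_image_of_injective _ iD]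
  have hfin : {q : (ℤ × ℤ) × (ℤ × ℤ) |
    q.1.2 = q.2.2 ∧ |q.1.1 - q.2.1| = 1 ∧ q.1 ∈ F ∧ q.2 ∉ F}.Finite := by
    refine Set.Finite.subset (Finset.finite_toSet (F ×ˢ
      (F.image (fun p => (p.1 + 1, p.2)) ∪ F.image (fun p => (p.1 - 1, p.2))))) ?_
    rintro ⟨⟨a, b⟩, ⟨a', b'⟩⟩ ⟨h1, h2, h3, h4⟩
    simp only at h1 h2 h3 h4
    subst h1
    simp only [Finset.coe_product, Set.mem_prod, Finset.mem_coe, Finset.mem_union,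
      Finset.mem_image]
    refine ⟨h3, ?_⟩
    rcases abs_eq (by norm_num : (0 : ℤ) ≤ 1) |>.1 h2 with h | h
    · right
      exact ⟨_, h3, by ext <;> simp; omega⟩
    · left
      exact ⟨_, h3, by ext <;> simp; omega⟩
  have hle : (U.image fU ∪ D.image fD).card ≤ horizBoundaryLen F := by
    unfold horizBoundaryLen
    rw [← Set.ncard_coe_finset]
    refine Set.ncard_le_ncard ?_ hfin
    intro q hq
    rw [Finset.mem_coe, Finset.mem_union] at hq
    rcases hq with hq | hq
    · obtain ⟨⟨a, b⟩, h, rfl⟩ := Finset.mem_image.1 hq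
      have h := (Finset.mem_filter.1 h).2
      refine ⟨rfl, ?_, h.1, h.2⟩
      simp [fU]
    · obtain ⟨⟨a, b⟩, h, rfl⟩ := Finset.mem_image.1 hq
      have h := (Finset.mem_filter.1 h).2
      refine ⟨rfl, ?_, h.1, h.2⟩
      simp [fD]
  rw [hcard] at hle
  exact_mod_cast hle

/-- alternating sums of `g = ∑ e_j` are bounded by the sum of the descents -/
theorem alt_sum_le (J : Finset ℤ) (e : ℤ → ℕ → ℤ) (v : ℕ → ℕ) (a b t : ℕ)
    (hm : ∀ i j, i < j → j < 2 * t → v i < v j) (hr : ∀ i, i < 2 * t → a ≤ v i ∧ v i ≤ b) :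
    ∑ u ∈ Finset.range t, (∑ j ∈ J, e j (v (2 * u)) - ∑ j ∈ J, e j (v (2 * u + 1)))
      ≤ ∑ j ∈ J, desc (e j) a b := by
  simp only [← Finset.sum_sub_distrib]
  rw [Finset.sum_comm]
  exact Finset.sum_le_sum (fun j _ => alt_le (e j) v a t b hm hr)

/-- Corollary 2 (the general variation): with `d_0 = d_{m+1} = 0`, `d_k < 0`,
`d_{k+1} ≥ 0` and `σ = Σ_{i=1}^k d_i`, for any indices
`i_1 < ⋯ < i_{2t+1}` from `{0, 1, …, k, m+1}` and
`ĩ_1 < ⋯ < ĩ_{2s+1}` from `{0, k+1, …, m, m+1}` we have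
`L_h ≥ 2 r_1 + (d_{i_1} - d_{i_2} + ⋯ - d_{i_{2t}} + 2 d_{i_{2t+1}})
        + (d_{ĩ_1} - d_{ĩ_2} + ⋯ - d_{ĩ_{2s}} + 2 d_{ĩ_{2s+1}}) - σ`.
Here `idx 0, …, idx (2t)` play the role of `i_1 < ⋯ < i_{2t+1}` and
`tidx 0, …, tidx (2s)` the role of `ĩ_1 < ⋯ < ĩ_{2s+1}`. -/
theorem boundary_lower_bound_split_general (m n : ℕ) (hm : 0 < m) (hn : 0 < n)
    (F : Finset (ℤ × ℤ))
    (hF : ∀ p ∈ F, p.1 ∈ Finset.Icc (1 : ℤ) (m : ℤ) ∧ p.2 ∈ Finset.Icc (1 : ℤ) (n : ℤ))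
    (b : ℤ → ℕ)
    (hb : ∀ i : ℤ, b i = ((Finset.Icc (1 : ℤ) (n : ℤ)).filter fun j => i ≤ (colSum F j : ℤ)).card)
    (d : ℤ → ℤ)
    (hd : ∀ i : ℤ, 1 ≤ i → i ≤ (m : ℤ) → d i = (b i : ℤ) - (rowSum F i : ℤ))
    (hd0 : d 0 = 0) (hdm1 : d ((m : ℤ) + 1) = 0)
    (k : ℤ) (hk1 : 1 ≤ k) (hkm : k ≤ (m : ℤ))
    (hdk : d k < 0) (hdk1 : 0 ≤ d (k + 1))
    (σ : ℤ) (hσ : σ = ∑ i ∈ Finset.Icc (1 : ℤ) k, d i)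
    (t s : ℕ)
    (idx : ℕ → ℤ)
    (hidx_mono : ∀ a b : ℕ, a < b → b ≤ 2 * t → idx a < idx b)
    (hidx_range : ∀ u : ℕ, u ≤ 2 * t → idx u ∈ insert ((m : ℤ) + 1) (Finset.Icc (0 : ℤ) k))
    (tidx : ℕ → ℤ)
    (htidx_mono : ∀ a b : ℕ, a < b → b ≤ 2 * s → tidx a < tidx b)
    (htidx_range : ∀ u : ℕ, u ≤ 2 * s →
      tidx u ∈ insert (0 : ℤ) (Finset.Icc (k + 1) ((m : ℤ) + 1))) :
    (horizBoundaryLen F : ℤ) ≥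
      2 * (rowSum F 1 : ℤ)
        + ((∑ u ∈ Finset.range t, (d (idx (2 * u)) - d (idx (2 * u + 1))))
            + 2 * d (idx (2 * t)))
        + ((∑ u ∈ Finset.range s, (d (tidx (2 * u)) - d (tidx (2 * u + 1))))
            + 2 * d (tidx (2 * s)))
        - σ := by
  obtain ⟨K, rfl⟩ : ∃ K : ℕ, k = K := ⟨k.toNat, by omega⟩
  have hK1 : 1 ≤ K := by omega
  have hKm : K ≤ m := by omega
  set J := Finset.Icc (1 : ℤ) n with hJ
  have hcol := col_of m n F hF
  have hdE : ∀ i : ℕ, i ≤ m + 1 → d i = ∑ j ∈ J, colE F j i := by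
    intro i hi
    by_cases h0 : i = 0
    · subst h0
      simp [colE, hd0]
    · by_cases h1 : i = m + 1
      · subst h1
        push_cast
        rw [hdm1]
        refine (Finset.sum_eq_zero (fun j _ => ?_)).symm
        rw [(hcol j).he _ (by omega), if_neg (by have := (hcol j).cm; omega),
          (hcol j).hxm _ (by omega)]
        simp
      · rw [hd i (by omega) (by omega), hb, rowSum_eq m n F hF, Finset.card_filter]
        push_cast
        rw [← Finset.sum_sub_distrib]
        refine Finset.sum_congr rfl (fun j _ => ?_)
        rw [(hcol j).he _ (by omega)]
        simp
  have hσE : σ = ∑ j ∈ J, ∑ i ∈ Finset.Ico 1 (K + 1), colE F j i := by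
    rw [hσ, Finset.sum_comm]
    refine Finset.sum_nbij' (fun i => i.toNat) (fun i => (i : ℤ)) ?_ ?_ ?_ ?_ ?_
    · intro i hi
      simp only [Finset.mem_Icc, Finset.mem_Ico] at hi ⊢
      omega
    · intro i hi
      simp only [Finset.mem_Icc, Finset.mem_Ico] at hi ⊢
      omega
    · intro i hi
      simp only [Finset.mem_Icc] at hi
      omega
    · intro i hi
      simp
    · intro i hi
      simp only [Finset.mem_Icc] at hi
      rw [← hdE _ (by omega), Int.toNat_of_nonneg (by omega)]
  have hr1 : (rowSum F 1 : ℤ) = ∑ j ∈ J, colX F j 1 := by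
    have := rowSum_eq m n F hF 1
    simpa using this
  -- the first alternating sum
  have hAex : ∃ A : ℤ → ℤ, (∀ j, A j = desc (colE F j) 0 K ∨
      ∃ p, p < K ∧ A j = desc (colE F j) 0 p + 2 * colE F j p) ∧
      (∑ u ∈ Finset.range t, (d (idx (2 * u)) - d (idx (2 * u + 1))))
            + 2 * d (idx (2 * t)) ≤ ∑ j ∈ J, A j := by
    have hrange : ∀ u, u ≤ 2 * t → idx u = m + 1 ∨ (0 ≤ idx u ∧ idx u ≤ K) := by
      intro u hu
      have := hidx_range u hu
      simpa only [Finset.mem_insert, Finset.mem_Icc] using this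
    have hlt : ∀ u, u < 2 * t → idx u < idx (2 * t) := fun u hu => hidx_mono u _ hu le_rfl
    have hlow : ∀ u, u < 2 * t → 0 ≤ idx u ∧ idx u ≤ K := by
      intro u hu
      have h1 := hlt u hu
      have h2 := hrange u hu.le
      have h3 := hrange (2 * t) le_rfl
      omega
    have hsum : ∑ u ∈ Finset.range t, (d (idx (2 * u)) - d (idx (2 * u + 1))) =
        ∑ u ∈ Finset.range t, (∑ j ∈ J, colE F j ((fun w => (idx w).toNat) (2 * u)) -
          ∑ j ∈ J, colE F j ((fun w => (idx w).toNat) (2 * u + 1))) := by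
      refine Finset.sum_congr rfl (fun u hu => ?_)
      rw [Finset.mem_range] at hu
      have h1 := hlow (2 * u) (by omega)
      have h2 := hlow (2 * u + 1) (by omega)
      rw [← hdE _ (by simp only; omega), ← hdE _ (by simp only; omega),
        Int.toNat_of_nonneg h1.1, Int.toNat_of_nonneg h2.1]
    have hmono : ∀ i j, i < j → j < 2 * t →
        (fun w => (idx w).toNat) i < (fun w => (idx w).toNat) j := by
      intro i j hij hj
      have := hidx_mono i j hij hj.le
      have := hlow i (by omega)
      simp only
      omega
    by_cases hlast : 0 ≤ idx (2 * t) ∧ idx (2 * t) < K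
    · refine ⟨fun j => desc (colE F j) 0 (idx (2 * t)).toNat +
        2 * colE F j (idx (2 * t)).toNat, fun j => Or.inr ⟨_, by omega, rfl⟩, ?_⟩
      have h1 := alt_sum_le J (colE F) (fun w => (idx w).toNat) 0 (idx (2 * t)).toNat t hmono
        (fun i hi => ⟨Nat.zero_le _, by have := hlt i hi; omega⟩)
      rw [hsum, Finset.sum_add_distrib, ← Finset.mul_sum, ← hdE _ (by omega),
        Int.toNat_of_nonneg hlast.1]
      linarith
    · refine ⟨fun j => desc (colE F j) 0 K, fun j => Or.inl rfl, ?_⟩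
      have h1 := alt_sum_le J (colE F) (fun w => (idx w).toNat) 0 K t hmono
        (fun i hi => ⟨Nat.zero_le _, by have := hlow i hi; omega⟩)
      have h2 : d (idx (2 * t)) ≤ 0 := by
        rcases hrange (2 * t) le_rfl with h | h
        · rw [h, hdm1]
        · have : idx (2 * t) = K := by omega
          rw [this]
          exact hdk.le
      rw [hsum]
      linarith
  -- the second alternating sum
  have hBex : ∃ q : ℕ, K + 1 ≤ q ∧ q ≤ m + 1 ∧
      (∑ u ∈ Finset.range s, (d (tidx (2 * u)) - d (tidx (2 * u + 1))))
            + 2 * d (tidx (2 * s))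
        ≤ ∑ j ∈ J, (desc (colE F j) (K + 1) q + 2 * colE F j q) := by
    have hrange : ∀ u, u ≤ 2 * s → tidx u = 0 ∨ ((K : ℤ) + 1 ≤ tidx u ∧ tidx u ≤ m + 1) := by
      intro u hu
      have := htidx_range u hu
      simpa only [Finset.mem_insert, Finset.mem_Icc] using this
    -- general bound for sequences inside `[K+1, m+1]`
    have hgen : ∀ (s : ℕ) (y : ℕ → ℤ), (∀ a b : ℕ, a < b → b ≤ 2 * s → y a < y b) →
        (∀ u, u ≤ 2 * s → (K : ℤ) + 1 ≤ y u ∧ y u ≤ m + 1) →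
        ∃ q : ℕ, K + 1 ≤ q ∧ q ≤ m + 1 ∧
        (∑ u ∈ Finset.range s, (d (y (2 * u)) - d (y (2 * u + 1)))) + 2 * d (y (2 * s))
          ≤ ∑ j ∈ J, (desc (colE F j) (K + 1) q + 2 * colE F j q) := by
      intro s y hy hyr
      have hl := hyr (2 * s) le_rfl
      refine ⟨(y (2 * s)).toNat, by omega, by omega, ?_⟩
      have h1 := alt_sum_le J (colE F) (fun w => (y w).toNat) (K + 1) (y (2 * s)).toNat s
        (by
          intro i j hij hj
          have := hy i j hij hj.le
          have := hyr i (by omega)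
          omega)
        (by
          intro i hi
          have := hy i (2 * s) hi le_rfl
          have := hyr i (by omega)
          omega)
      have hsum : ∑ u ∈ Finset.range s, (d (y (2 * u)) - d (y (2 * u + 1))) =
        ∑ u ∈ Finset.range s, (∑ j ∈ J, colE F j ((fun w => (y w).toNat) (2 * u)) -
          ∑ j ∈ J, colE F j ((fun w => (y w).toNat) (2 * u + 1))) := by
        refine Finset.sum_congr rfl (fun u hu => ?_)
        rw [Finset.mem_range] at hu
        have h1 := hyr (2 * u) (by omega)
        have h2 := hyr (2 * u + 1) (by omega)
        rw [← hdE _ (by simp only; omega), ← hdE _ (by simp only; omega),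
          Int.toNat_of_nonneg (by omega), Int.toNat_of_nonneg (by omega)]
      rw [hsum, Finset.sum_add_distrib, ← Finset.mul_sum, ← hdE _ (by omega),
        Int.toNat_of_nonneg (by omega)]
      linarith
    have hpos : ∀ u, 1 ≤ u → u ≤ 2 * s → (K : ℤ) + 1 ≤ tidx u ∧ tidx u ≤ m + 1 := by
      intro u h1 hu
      have h2 := htidx_mono 0 u (by omega) hu
      have h3 := hrange 0 (by omega)
      have h4 := hrange u hu
      omega
    rcases hrange 0 (by omega) with h0 | h0
    · rcases Nat.eq_zero_or_pos s with hs | hs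
      · subst hs
        obtain ⟨q, hq1, hq2, hq⟩ := hgen 0 (fun _ => (K : ℤ) + 1) (by intros; omega)
          (by intros; omega)
        refine ⟨q, hq1, hq2, le_trans ?_ hq⟩
        simp [h0, hd0, hdk1]
      · obtain ⟨s, rfl⟩ : ∃ s', s = s' + 1 := ⟨s - 1, by omega⟩
        by_cases h1 : tidx 1 = K + 1
        · obtain ⟨q, hq1, hq2, hq⟩ := hgen s (fun u => tidx (u + 2))
            (fun a b hab hb => htidx_mono _ _ (by omega) (by omega))
            (fun u hu => hpos _ (by omega) (by omega))
          refine ⟨q, hq1, hq2, le_trans ?_ hq⟩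
          rw [Finset.sum_range_succ']
          simp only [mul_zero, zero_add, h0, hd0, h1, mul_add, mul_one]
          have : ∑ u ∈ Finset.range s, (d (tidx (2 * u + 2)) - d (tidx (2 * u + 2 + 1))) =
            ∑ u ∈ Finset.range s, (d (tidx (2 * u + 2)) - d (tidx (2 * u + 1 + 2))) := rfl
          linarith
        · obtain ⟨q, hq1, hq2, hq⟩ := hgen (s + 1)
            (fun u => if u = 0 then (K : ℤ) + 1 else tidx u)
            (by
              intro a b hab hb
              have hb' := htidx_mono a b hab hb
              have h2 := hpos 1 le_rfl (by omega)
              rw [if_neg (by omega : b ≠ 0)]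
              split_ifs with ha
              · rcases Nat.lt_or_ge 1 b with hb1 | hb1
                · have := htidx_mono 1 b hb1 hb
                  omega
                · have : b = 1 := by omega
                  subst this
                  omega
              · exact hb')
            (by
              intro u hu
              split_ifs with ha
              · omega
              · exact hpos u (by omega) hu)
          refine ⟨q, hq1, hq2, le_trans ?_ hq⟩
          rw [Finset.sum_range_succ', Finset.sum_range_succ']
          simp [h0, hd0, hdk1]
    · refine hgen s tidx htidx_mono (fun u hu => ?_)
      rcases Nat.eq_zero_or_pos u with h | h
      · rw [h]
        exact h0
      · exact hpos u h hu
  obtain ⟨A, hA, hA'⟩ := hAex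
  obtain ⟨q, hq1, hq2, hq⟩ := hBex
  have hfinal := Finset.sum_le_sum (s := J)
    (fun j _ => (hcol j).main hK1 hKm hq1 hq2 (A j) (hA j))
  rw [Finset.sum_sub_distrib, Finset.sum_add_distrib, Finset.sum_add_distrib,
    ← Finset.mul_sum] at hfinal
  have hbd := boundary_ge m n F hF
  rw [← hr1, ← hσE] at hfinal
  linarith
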